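/- arXiv:2605.06521 — 2 statements merged into one kernel-verified Lean document; each statement's English description precedes it below -/
import Mathlib

section
/- Let M^∞ = (M_t)_{t≥0} be any non-negative martingale under π₀^⊗ with M₀ = 1, adapted to the natural filtration of the observations, and suppose π₁ ≪ π₀. Then there exists a policy A^∞ in the canonical action space (𝒫^{π₀}, φ^{π₀}) whose wealth process satisfies Ŵ_t^{A^∞} = M_t for every t ≥ 0, π₁^⊗-almost surely; consequently the rejection times agree π₁^⊗-almost surely. -/
open MeasureTheory ProbabilityTheory ENNReal NNReal Set Filter

attribute [local instance] Classical.propDecidable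

noncomputable section

variable {𝒳 𝒜 : Type*} [MeasurableSpace 𝒳] [MeasurableSpace 𝒜]

/-- `P` is the law of an i.i.d. sequence of draws from `π`: the infinite product measure
`π^⊗` on the path space `𝒳^∞`, characterized through its finite-dimensional marginals. -/
def IsIIDProduct {𝒳 : Type*} [MeasurableSpace 𝒳] (π : Measure 𝒳)
    (P : Measure (ℕ → 𝒳)) : Prop :=
  IsProbabilityMeasure P ∧
    ∀ n : ℕ, P.map (fun x (i : Fin n) => x i.val) = Measure.pi (fun _ : Fin n => π)

/-- The natural filtration of the observations on the path space `𝒳^∞`: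
`ℱ n` is the σ-algebra generated by the first `n` coordinates. -/
def coordFil (𝒳 : Type*) [MeasurableSpace 𝒳] :
    Filtration ℕ (inferInstance : MeasurableSpace (ℕ → 𝒳)) where
  seq n := ⨆ i ∈ Finset.range n, MeasurableSpace.comap (fun x : ℕ → 𝒳 => x i) inferInstance
  mono' := fun _ _ hnm =>
    biSup_mono fun _ hi => Finset.mem_range.mpr ((Finset.mem_range.mp hi).trans_le hnm)
  le' := fun _ => iSup₂_le fun i _ => (measurable_pi_apply i).comap_le

/-- Wealth of a policy `A` after `n` rounds, as a function of the first `n` observations. -/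
def finWealth (φ : 𝒜 → 𝒳 → ℝ≥0) (A : (n : ℕ) → (Fin n → 𝒳) → 𝒜) :
    (n : ℕ) → (Fin n → 𝒳) → ℝ≥0
  | 0, _ => 1
  | n + 1, p =>
      finWealth φ A n (fun i => p i.castSucc) * φ (A n (fun i => p i.castSucc)) (p (Fin.last n))

/-- Wealth process of a policy `A` on the path space. -/
def polWealth (φ : 𝒜 → 𝒳 → ℝ≥0) (A : (n : ℕ) → (Fin n → 𝒳) → 𝒜) (n : ℕ) (x : ℕ → 𝒳) : ℝ≥0 :=
  finWealth φ A n (fun i => x i.val)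

/-- Rejection time of a policy: the first round `t ≥ 1` at which the wealth reaches `α⁻¹`
(`⊤ = ∞` if this never happens). -/
def polRejTime (φ : 𝒜 → 𝒳 → ℝ≥0) (α : ℝ≥0) (A : (n : ℕ) → (Fin n → 𝒳) → 𝒜)
    (x : ℕ → 𝒳) : ℕ∞ :=
  ⨅ (t : ℕ) (_ : 1 ≤ t ∧ α⁻¹ ≤ polWealth φ A t x), (t : ℕ∞)

/-- Appending an independent coordinate turns the `n`-fold power of `π` into its
`(n + 1)`-fold power. -/
theorem measurePreserving_finSnoc (π : Measure 𝒳) [IsProbabilityMeasure π] (n : ℕ) :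
    MeasurePreserving (fun q : (Fin n → 𝒳) × 𝒳 => (Fin.snoc q.1 q.2 : Fin (n + 1) → 𝒳))
      ((Measure.pi fun _ : Fin n => π).prod π) (Measure.pi fun _ : Fin (n + 1) => π) := by
  have hmeas : Measurable
      (fun q : (Fin n → 𝒳) × 𝒳 => (Fin.snoc q.1 q.2 : Fin (n + 1) → 𝒳)) := by
    refine measurable_pi_iff.2 fun i => ?_
    refine Fin.lastCases ?_ (fun j => ?_) i
    · simpa using measurable_snd
    · simpa [Function.comp_def] using (measurable_pi_apply j).comp measurable_fst
  refine ⟨hmeas, (Measure.pi_eq fun s hs => ?_).symm⟩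
  rw [Measure.map_apply hmeas (MeasurableSet.univ_pi hs)]
  have hpre : (fun q : (Fin n → 𝒳) × 𝒳 => (Fin.snoc q.1 q.2 : Fin (n + 1) → 𝒳)) ⁻¹' univ.pi s
      = (univ.pi fun j : Fin n => s j.castSucc) ×ˢ s (Fin.last n) := by
    ext q
    simp [Fin.forall_fin_succ']
  rw [hpre, Measure.prod_prod, Measure.pi_pi, Fin.prod_univ_castSucc]

theorem pi_const_absolutelyContinuous {π₀ π₁ : Measure 𝒳} [IsProbabilityMeasure π₀]
    [IsProbabilityMeasure π₁] (hac : π₁ ≪ π₀) (n : ℕ) :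
    Measure.pi (fun _ : Fin n => π₁) ≪ Measure.pi (fun _ : Fin n => π₀) := by
  induction n with
  | zero => rw [Measure.pi_of_empty, Measure.pi_of_empty]
  | succ n ih =>
    rw [← (measurePreserving_finSnoc π₁ n).map_eq, ← (measurePreserving_finSnoc π₀ n).map_eq]
    exact (ih.prod hac).map (measurePreserving_finSnoc π₀ n).measurable

theorem coordFil_eq_comap (n : ℕ) :
    coordFil 𝒳 n
      = MeasurableSpace.comap (fun (x : ℕ → 𝒳) (i : Fin n) => x i.val) inferInstance := by
  change (⨆ i ∈ Finset.range n, MeasurableSpace.comap (fun x : ℕ → 𝒳 => x i) inferInstance) = _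
  simp only [MeasurableSpace.pi, MeasurableSpace.comap_iSup, MeasurableSpace.comap_comp]
  apply le_antisymm
  · exact iSup₂_le fun i hi => le_iSup_of_le (⟨i, Finset.mem_range.1 hi⟩ : Fin n) le_rfl
  · exact iSup_le fun i => le_iSup₂_of_le i.val (Finset.mem_range.2 i.isLt) le_rfl

/-- A nonnegative process adapted to the natural filtration is a measurable function of the
observations seen so far. -/
theorem exists_measurable_prefix_eq {n : ℕ} {f : (ℕ → 𝒳) → ℝ}
    (hf : StronglyMeasurable[coordFil 𝒳 n] f) (hf0 : ∀ x, 0 ≤ f x) :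
    ∃ m : (Fin n → 𝒳) → ℝ≥0, Measurable m ∧ ∀ x, f x = m (fun i => x i.val) := by
  rw [coordFil_eq_comap] at hf
  obtain ⟨h, hh, hfh⟩ := hf.exists_eq_measurable_comp
  refine ⟨fun p => (h p).toNNReal, hh.measurable.real_toNNReal, fun x => ?_⟩
  have hx : f x = h (fun i => x i.val) := congrFun hfh x
  simp only [← hx, Real.coe_toNNReal _ (hf0 x)]

/-- The martingale property in terms of the finite-dimensional factorizations: averaging over
the next observation gives back the current value. -/
theorem ae_lintegral_snoc_eq {π : Measure 𝒳} [IsProbabilityMeasure π] {P : Measure (ℕ → 𝒳)}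
    (hP : IsIIDProduct π P) {M : ℕ → (ℕ → 𝒳) → ℝ} (hM : Martingale M (coordFil 𝒳) P)
    {m : (n : ℕ) → (Fin n → 𝒳) → ℝ≥0} (hm : ∀ n, Measurable (m n))
    (hMm : ∀ n x, M n x = m n (fun i => x i.val)) (n : ℕ) :
    ∀ᵐ p ∂(Measure.pi fun _ : Fin n => π),
      ∫⁻ y, (m (n + 1) (Fin.snoc p y) : ℝ≥0∞) ∂π = m n p := by
  have := hP.1
  have hres (k : ℕ) : MeasurePreserving (fun (x : ℕ → 𝒳) (i : Fin k) => x i.val) P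
      (Measure.pi fun _ : Fin k => π) :=
    ⟨measurable_pi_iff.2 fun i => measurable_pi_apply _, hP.2 k⟩
  have hsnoc := measurePreserving_finSnoc π n
  have hjoint : Measurable fun q : (Fin n → 𝒳) × 𝒳 => (m (n + 1) (Fin.snoc q.1 q.2) : ℝ≥0∞) :=
    ((hm (n + 1)).comp hsnoc.measurable).coe_nnreal_ennreal
  refine ae_eq_of_forall_setLIntegral_eq_of_sigmaFinite hjoint.lintegral_prod_right'
    (hm n).coe_nnreal_ennreal fun s hs _ => ?_
  have hinit : Measurable fun (p : Fin (n + 1) → 𝒳) (i : Fin n) => p i.castSucc :=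
    measurable_pi_iff.2 fun i => measurable_pi_apply _
  have hpath (k : ℕ) (S : Set (ℕ → 𝒳)) :
      ∫⁻ x in S, (m k (fun i => x i.val) : ℝ≥0∞) ∂P = ENNReal.ofReal (∫ x in S, M k x ∂P) := by
    rw [ofReal_integral_eq_lintegral_ofReal (hM.integrable k).integrableOn
      (Eventually.of_forall fun x => by simp [hMm])]
    simp [hMm]
  have hset := hM.setIntegral_eq (Nat.le_succ n)
    (s := (fun (x : ℕ → 𝒳) (i : Fin n) => x i.val) ⁻¹' s)
    (by rw [coordFil_eq_comap]; exact ⟨s, hs, rfl⟩)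
  calc ∫⁻ p in s, ∫⁻ y, (m (n + 1) (Fin.snoc p y) : ℝ≥0∞) ∂π ∂(Measure.pi fun _ => π)
      = ∫⁻ q in s ×ˢ univ, (m (n + 1) (Fin.snoc q.1 q.2) : ℝ≥0∞)
          ∂((Measure.pi fun _ => π).prod π) := by
        rw [← Measure.prod_restrict, Measure.restrict_univ, lintegral_prod _ hjoint.aemeasurable]
    _ = ∫⁻ p in (fun p (i : Fin n) => p i.castSucc) ⁻¹' s, (m (n + 1) p : ℝ≥0∞)
          ∂(Measure.pi fun _ => π) := by
        rw [← hsnoc.setLIntegral_comp_preimage (hinit hs) (hm (n + 1)).coe_nnreal_ennreal]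
        congr 2
        ext q
        simp
    _ = ∫⁻ x in (fun (x : ℕ → 𝒳) (i : Fin n) => x i.val) ⁻¹' s,
          (m (n + 1) (fun i => x i.val) : ℝ≥0∞) ∂P := by
        rw [← (hres (n + 1)).setLIntegral_comp_preimage (hinit hs)
          (hm (n + 1)).coe_nnreal_ennreal]
        rfl
    _ = ∫⁻ x in (fun (x : ℕ → 𝒳) (i : Fin n) => x i.val) ⁻¹' s,
          (m n (fun i => x i.val) : ℝ≥0∞) ∂P := by
        rw [hpath, hpath, hset]
    _ = ∫⁻ p in s, (m n p : ℝ≥0∞) ∂(Measure.pi fun _ => π) :=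
        (hres n).setLIntegral_comp_preimage hs (hm n).coe_nnreal_ennreal

/-- Measurable selection of the normalized densities `g p / m p`, wherever they are
probability densities. -/
theorem exists_measurable_normalized_density {Y : Type*} [MeasurableSpace Y] (π : Measure 𝒳)
    [IsProbabilityMeasure π] {m : Y → ℝ≥0} (hm : Measurable m) {g : Y → 𝒳 → ℝ≥0}
    (hg : Measurable fun q : Y × 𝒳 => g q.1 q.2) :
    ∃ A : Y → {ν : Measure 𝒳 // IsProbabilityMeasure ν ∧ ν ≪ π}, Measurable A ∧
      ∀ p, m p ≠ 0 → ∫⁻ y, (g p y : ℝ≥0∞) ∂π = m p →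
        (A p).1 = π.withDensity fun y => ((g p y / m p : ℝ≥0) : ℝ≥0∞) := by
  have hgp (p : Y) : Measurable (g p) := hg.comp measurable_prodMk_left
  have hdens : Measurable fun q : Y × 𝒳 => ((g q.1 q.2 / m q.1 : ℝ≥0) : ℝ≥0∞) :=
    (hg.div (hm.comp measurable_fst)).coe_nnreal_ennreal
  let S : Set Y := {p | m p ≠ 0 ∧ ∫⁻ y, (g p y : ℝ≥0∞) ∂π = m p}
  have hS : MeasurableSet S := by
    refine MeasurableSet.inter (hm (measurableSet_singleton 0).compl) ?_
    exact measurableSet_eq_fun hg.coe_nnreal_ennreal.lintegral_prod_right'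
      hm.coe_nnreal_ennreal
  let ν : Y → Measure 𝒳 := fun p =>
    if p ∈ S then π.withDensity fun y => ((g p y / m p : ℝ≥0) : ℝ≥0∞) else π
  have hν (p : Y) : IsProbabilityMeasure (ν p) ∧ ν p ≪ π := by
    by_cases hp : p ∈ S
    · have hνp : ν p = π.withDensity fun y => ((g p y / m p : ℝ≥0) : ℝ≥0∞) := if_pos hp
      rw [hνp]
      refine ⟨⟨?_⟩, withDensity_absolutelyContinuous _ _⟩
      simp_rw [withDensity_apply _ MeasurableSet.univ, Measure.restrict_univ,
        ENNReal.coe_div hp.1, div_eq_mul_inv]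
      rw [lintegral_mul_const _ (hgp p).coe_nnreal_ennreal, hp.2]
      exact ENNReal.mul_inv_cancel (by simpa using hp.1) ENNReal.coe_ne_top
    · have hνp : ν p = π := if_neg hp
      rw [hνp]
      exact ⟨inferInstance, Measure.AbsolutelyContinuous.rfl⟩
  refine ⟨fun p => ⟨ν p, hν p⟩, Measurable.subtype_mk ?_, fun p h0 h1 => if_pos ⟨h0, h1⟩⟩
  refine Measurable.ite hS (Measure.measurable_of_measurable_coe _ fun B hB => ?_)
    measurable_const
  simp_rw [withDensity_apply _ hB]
  exact hdens.lintegral_prod_right'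

/-- A density map agrees almost everywhere with any measurable density of the same measure. -/
theorem density_ae_eq_of_withDensity {π ν : Measure 𝒳} [IsProbabilityMeasure π]
    {f h : 𝒳 → ℝ≥0} (hf : Measurable f) (hh : Measurable h)
    (hνf : ∀ B, MeasurableSet B → ν B = ∫⁻ x in B, (f x : ℝ≥0∞) ∂π)
    (hνh : ν = π.withDensity fun x => (h x : ℝ≥0∞)) : f =ᵐ[π] h := by
  have hfh : (fun x => (f x : ℝ≥0∞)) =ᵐ[π] fun x => (h x : ℝ≥0∞) :=
    ae_eq_of_forall_setLIntegral_eq_of_sigmaFinite hf.coe_nnreal_ennreal hh.coe_nnreal_ennreal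
      fun B hB _ => by rw [← hνf B hB, hνh, withDensity_apply _ hB]
  filter_upwards [hfh] with x hx using ENNReal.coe_injective hx

theorem measurable_finWealth {φ : 𝒜 → 𝒳 → ℝ≥0}
    (hφ : Measurable fun p : 𝒜 × 𝒳 => φ p.1 p.2) {A : (n : ℕ) → (Fin n → 𝒳) → 𝒜}
    (hA : ∀ n, Measurable (A n)) (n : ℕ) : Measurable (finWealth φ A n) := by
  induction n with
  | zero => exact measurable_const
  | succ n ih =>
    have hinit : Measurable fun (p : Fin (n + 1) → 𝒳) (i : Fin n) => p i.castSucc :=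
      measurable_pi_iff.2 fun i => measurable_pi_apply _
    exact (ih.comp hinit).mul
      (hφ.comp (((hA n).comp hinit).prodMk (measurable_pi_apply (Fin.last n))))

/-- A property of the first `n + 1` observations holds almost surely if it does for almost every
last observation, given almost every prefix. -/
theorem ae_pi_succ_of_ae_snoc {π : Measure 𝒳} [IsProbabilityMeasure π] {n : ℕ}
    {r : (Fin (n + 1) → 𝒳) → Prop} (hr : MeasurableSet {p | r p})
    (h : ∀ᵐ p ∂(Measure.pi fun _ : Fin n => π), ∀ᵐ y ∂π, r (Fin.snoc p y)) :
    ∀ᵐ p ∂(Measure.pi fun _ : Fin (n + 1) => π), r p := by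
  have hsnoc := measurePreserving_finSnoc π n
  rw [← hsnoc.map_eq]
  refine (ae_map_iff hsnoc.aemeasurable hr).2 ?_
  exact (Measure.ae_prod_iff_ae_ae (hsnoc.measurable hr)).2 h

theorem martingale_realized_as_wealth
    (𝒳 : Type*) [MeasurableSpace 𝒳] [StandardBorelSpace 𝒳]
    (π₀ π₁ : Measure 𝒳) [IsProbabilityMeasure π₀] [IsProbabilityMeasure π₁]
    (hac : π₁ ≪ π₀)
    (φ : {ν : Measure 𝒳 // IsProbabilityMeasure ν ∧ ν ≪ π₀} → 𝒳 → ℝ≥0)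
    (hφmeas : Measurable (fun p : {ν : Measure 𝒳 // IsProbabilityMeasure ν ∧ ν ≪ π₀} × 𝒳 =>
      φ p.1 p.2))
    (hφdens : ∀ (ν : {ν : Measure 𝒳 // IsProbabilityMeasure ν ∧ ν ≪ π₀}) (B : Set 𝒳),
      MeasurableSet B → ν.1 B = ∫⁻ x in B, (φ ν x : ℝ≥0∞) ∂π₀)
    (P₀ P₁ : Measure (ℕ → 𝒳)) (hP₀ : IsIIDProduct π₀ P₀) (hP₁ : IsIIDProduct π₁ P₁)
    (α : ℝ≥0) (hα : 0 < α) (hα1 : α < 1)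
    (M : ℕ → (ℕ → 𝒳) → ℝ) (hM : Martingale M (coordFil 𝒳) P₀)
    (hMnonneg : ∀ t x, 0 ≤ M t x) (hM0 : ∀ x, M 0 x = 1) :
    ∃ A : (n : ℕ) → (Fin n → 𝒳) → {ν : Measure 𝒳 // IsProbabilityMeasure ν ∧ ν ≪ π₀},
      (∀ n, Measurable (A n)) ∧
      (∀ᵐ x ∂P₁, ∀ t, ((polWealth φ A t x : ℝ)) = M t x) ∧
      (∀ᵐ x ∂P₁, polRejTime φ α A x
          = ⨅ (t : ℕ) (_ : ((α⁻¹ : ℝ≥0) : ℝ) ≤ M t x), (t : ℕ∞)) := by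
  choose m hm hMm using fun n => exists_measurable_prefix_eq (hM.stronglyMeasurable n) (hMnonneg n)
  have hg (n : ℕ) : Measurable fun q : (Fin n → 𝒳) × 𝒳 => m (n + 1) (Fin.snoc q.1 q.2) :=
    (hm (n + 1)).comp (measurePreserving_finSnoc π₀ n).measurable
  choose A hA hAdens using fun n =>
    exists_measurable_normalized_density π₀ (hm n) (g := fun p y => m (n + 1) (Fin.snoc p y)) (hg n)
  have hm0 (p : Fin 0 → 𝒳) : m 0 p = 1 := by
    have : Nonempty 𝒳 := nonempty_of_isProbabilityMeasure π₀
    have h := hMm 0 (fun _ => Classical.arbitrary 𝒳)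
    rw [hM0] at h
    rw [Subsingleton.elim p fun i => Classical.arbitrary 𝒳]
    exact_mod_cast h.symm
  have hfin (n : ℕ) : ∀ᵐ p ∂(Measure.pi fun _ : Fin n => π₀), finWealth φ A n p = m n p := by
    induction n with
    | zero => exact Eventually.of_forall fun p => (hm0 p).symm
    | succ n ih =>
      refine ae_pi_succ_of_ae_snoc
        (measurableSet_eq_fun (measurable_finWealth hφmeas hA (n + 1)) (hm (n + 1))) ?_
      filter_upwards [ih, ae_lintegral_snoc_eq hP₀ hM hm hMm n] with p hp havg
      have hgp : Measurable fun y => m (n + 1) (Fin.snoc p y) :=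
        (hg n).comp measurable_prodMk_left
      have hstep (y : 𝒳) :
          finWealth φ A (n + 1) (Fin.snoc p y) = m n p * φ (A n p) y := by
        simp [finWealth, hp]
      by_cases h0 : m n p = 0
      · rw [h0, ENNReal.coe_zero, lintegral_eq_zero_iff hgp.coe_nnreal_ennreal] at havg
        filter_upwards [havg] with y hy
        have hy0 : m (n + 1) (Fin.snoc p y) = 0 := by simpa using hy
        rw [hstep, h0, hy0, zero_mul]
      · filter_upwards [density_ae_eq_of_withDensity (hφmeas.comp measurable_prodMk_left)
          (hgp.div_const (m n p)) (hφdens (A n p)) (hAdens n p h0 havg)] with y hy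
        rw [hstep, show φ (A n p) y = _ from hy]
        exact mul_div_cancel₀ _ h0
  have hwealth : ∀ᵐ x ∂P₁, ∀ t, (polWealth φ A t x : ℝ) = M t x := by
    refine ae_all_iff.2 fun t => ?_
    have hres : Measurable fun (x : ℕ → 𝒳) (i : Fin t) => x i.val :=
      measurable_pi_iff.2 fun i => measurable_pi_apply _
    have h := (pi_const_absolutelyContinuous hac t).ae_le (hfin t)
    rw [← hP₁.2 t] at h
    filter_upwards [ae_of_ae_map hres.aemeasurable h] with x hx
    rw [hMm, polWealth, hx]
  refine ⟨A, hA, hwealth, ?_⟩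
  filter_upwards [hwealth] with x hx
  refine iInf_congr fun t => iInf_congr_Prop ?_ fun _ => rfl
  rw [← hx t, NNReal.coe_le_coe]
  refine and_iff_right_of_imp fun ht => Nat.one_le_iff_ne_zero.2 ?_
  rintro rfl
  exact absurd ht (not_le.2 (one_lt_inv₀ hα |>.2 hα1))

end
end

section
/- In Gaussian testing with π₀ = 𝒩(0,σ²) and π₁ = 𝒩(μ,σ²), μ > 0, consider the constant Gaussian-shift bet φ(a,x) = exp(ax/σ² - a²/(2σ²)) for a fixed a ∈ ℝ. Its log-growth under π₁ is γ(a) = 𝔼_{π₁}[log φ(a,·)] = (aμ - a²/2)/σ², so the constant strategy playing a has rejection probability one under π₁^⊗ (from any starting wealth in (0, α^{-1})) if and only if 0 < a ≤ 2μ. In particular the EDO action a⋆ = μ + 2σ²/(μT) yields power one if and only if T ≥ 2σ²/μ² = KL(π₁‖π₀)^{-1}. -/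
open MeasureTheory ProbabilityTheory ENNReal NNReal Set Filter

attribute [local instance] Classical.propDecidable

noncomputable section

/-- Wealth of the constant Gaussian-shift bet `φ(a,x) = exp(ax/σ² - a²/(2σ²))`. -/
def gaussWealth (σ : ℝ≥0) (a : ℝ) : ℕ → (ℕ → ℝ) → ℝ
  | 0, _ => 1
  | n + 1, x => gaussWealth σ a n x
      * Real.exp (a * x n / (σ : ℝ) ^ 2 - a ^ 2 / (2 * (σ : ℝ) ^ 2))

section IIDGaussian

variable {Ω : Type*} [MeasurableSpace Ω] {P : Measure Ω}
  {Y : ℕ → Ω → ℝ} {m : ℝ} {v : ℝ≥0}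

/-- A finite sum of i.i.d. Gaussian variables is Gaussian. -/
lemma map_sum_gaussianReal [IsProbabilityMeasure P]
    (hY : ∀ i, Measurable (Y i)) (hind : iIndepFun Y P)
    (hlaw : ∀ i, P.map (Y i) = gaussianReal m v) (s : Finset ℕ) :
    P.map (fun ω => ∑ i ∈ s, Y i ω) = gaussianReal (s.card * m) (s.card * v) := by
  induction s using Finset.induction_on with
  | empty => simp
  | insert j s hj ih =>
    have h := gaussianReal_add_gaussianReal_of_indepFun
      (hind.indepFun_finsetSum_of_notMem hY hj).symm (hlaw j)
      (by rw [← ih]; congr 1; ext ω; simp)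
    rw [Finset.card_insert_of_notMem hj]
    convert h using 2
    · ext ω; simp [Finset.sum_insert hj]
    · push_cast; ring
    · push_cast; ring

lemma gaussianReal_real_Iio_lt_one (c : ℝ) {v : ℝ≥0} (hv : v ≠ 0) :
    (gaussianReal m v).real (Iio c) < 1 := by
  have hpos : 0 < (gaussianReal m v).real (Iio c)ᶜ := by
    rw [measureReal_def, ENNReal.toReal_pos_iff]
    refine ⟨pos_iff_ne_zero.2 fun h => ?_, measure_lt_top _ _⟩
    have := gaussianReal_absolutelyContinuous' m hv h
    simp [compl_Iio] at this
  rw [probReal_compl_eq_one_sub measurableSet_Iio] at hpos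
  linarith

/-- A Gaussian with nonnegative mean is below one standard deviation with at most the probability
that a standard Gaussian is below `1`. -/
lemma gaussianReal_real_Iio_le {K : ℝ} (hm : 0 ≤ m) (hv : v ≠ 0) (hK : K ≤ √(v : ℝ)) :
    (gaussianReal m v).real (Iio K) ≤ (gaussianReal 0 1).real (Iio 1) := by
  have hs : 0 < √(v : ℝ) := Real.sqrt_pos.2 (by positivity)
  have h1 : (gaussianReal 0 1).map (fun x => √(v : ℝ) * x) = gaussianReal 0 v := by
    rw [gaussianReal_map_const_mul]
    congr 1
    · simp
    · ext; simp
  have h2 : (gaussianReal 0 v).map (fun x => x + m) = gaussianReal m v := by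
    rw [gaussianReal_map_add_const]; simp
  rw [← h2, map_measureReal_apply (by fun_prop) measurableSet_Iio, ← h1,
    map_measureReal_apply (by fun_prop) (measurableSet_Iio.preimage (by fun_prop))]
  refine measureReal_mono fun x hx => ?_
  simp only [mem_preimage, mem_Iio] at hx ⊢
  by_contra! h
  nlinarith

/-- The event that the first `n` partial sums stay below `c` is independent of the sum of the next
`k` increments. -/
lemma real_inter_partialSums_lt (hY : ∀ i, Measurable (Y i)) (hind : iIndepFun Y P)
    (n k : ℕ) (c K : ℝ) :
    P.real ({ω | ∀ t, 1 ≤ t → t ≤ n → ∑ i ∈ Finset.range t, Y i ω < c} ∩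
        {ω | ∑ i ∈ Finset.Ico n (n + k), Y i ω < K}) =
      P.real {ω | ∀ t, 1 ≤ t → t ≤ n → ∑ i ∈ Finset.range t, Y i ω < c} *
        P.real {ω | ∑ i ∈ Finset.Ico n (n + k), Y i ω < K} := by
  have hdisj : Disjoint (Finset.range n) (Finset.Ico n (n + k)) := by
    rw [Finset.disjoint_left]
    intro i hi hi'
    simp only [Finset.mem_range, Finset.mem_Ico] at hi hi'
    omega
  have h := hind.indepFun_finset _ _ hdisj hY
  let B : Set (Finset.range n → ℝ) :=
    {y | ∀ t, 1 ≤ t → t ≤ n → ∑ i : Finset.range n, (if (i : ℕ) < t then y i else 0) < c}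
  let C : Set (Finset.Ico n (n + k) → ℝ) := {y | ∑ i : Finset.Ico n (n + k), y i < K}
  have hB : MeasurableSet B := by
    simp only [B, ofPred_forall]
    refine MeasurableSet.iInter fun t => MeasurableSet.iInter fun _ => MeasurableSet.iInter fun _ =>
      measurableSet_lt (Finset.measurable_sum _ fun i _ => ?_) measurable_const
    split_ifs <;> fun_prop
  have hC : MeasurableSet C := measurableSet_lt (by fun_prop) measurable_const
  have hAB : {ω | ∀ t, 1 ≤ t → t ≤ n → ∑ i ∈ Finset.range t, Y i ω < c} =
      (fun ω (i : Finset.range n) => Y i ω) ⁻¹' B := by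
    ext ω
    simp only [B, mem_ofPred_eq, mem_preimage]
    refine forall_congr' fun t => forall_congr' fun _ => forall_congr' fun ht => ?_
    have hsum : ∑ i : Finset.range n, (if (i : ℕ) < t then Y i ω else 0) =
        ∑ i ∈ Finset.range t, Y i ω := by
      rw [Finset.sum_coe_sort (Finset.range n) (fun i => if i < t then Y i ω else 0),
        ← Finset.sum_filter]
      congr 1
      ext i
      simp only [Finset.mem_filter, Finset.mem_range]
      omega
    rw [hsum]
  have hDC : {ω | ∑ i ∈ Finset.Ico n (n + k), Y i ω < K} =
      (fun ω (i : Finset.Ico n (n + k)) => Y i ω) ⁻¹' C := by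
    ext ω
    simp only [C, mem_ofPred_eq, mem_preimage]
    rw [Finset.sum_coe_sort (Finset.Ico n (n + k)) (fun i => Y i ω)]
  rw [hAB, hDC]
  simp only [measureReal_def]
  rw [h.measure_inter_preimage_eq_mul B C hB hC, ENNReal.toReal_mul]

/-- A Gaussian random walk with nonnegative drift almost surely reaches every level. -/
lemma gaussian_walk_hits [IsProbabilityMeasure P]
    (hY : ∀ i, Measurable (Y i)) (hind : iIndepFun Y P)
    (hlaw : ∀ i, P.map (Y i) = gaussianReal m v) (hm : 0 ≤ m) (hv : v ≠ 0) (c : ℝ) :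
    P {ω | ∃ t, 1 ≤ t ∧ c ≤ ∑ i ∈ Finset.range t, Y i ω} = 1 := by
  set A : ℕ → Set Ω := fun n => {ω | ∀ t, 1 ≤ t → t ≤ n → ∑ i ∈ Finset.range t, Y i ω < c}
    with hA
  have hAmeas : ∀ n, MeasurableSet (A n) := fun n => by
    simp only [hA, ofPred_forall]
    exact MeasurableSet.iInter fun t => MeasurableSet.iInter fun _ => MeasurableSet.iInter fun _ =>
      measurableSet_lt (by fun_prop) measurable_const
  have hAanti : Antitone A := fun n n' h ω hω t h1 h2 => hω t h1 (h2.trans h)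
  set q : ℝ := P.real (⋂ n, A n)
  set ρ : ℝ := (gaussianReal 0 1).real (Iio 1)
  have hρ : ρ < 1 := gaussianReal_real_Iio_lt_one 1 one_ne_zero
  have hbound : ∀ (n : ℕ) (M : ℝ),
      q ≤ P.real {ω | ∑ i ∈ Finset.range n, Y i ω ≤ -M} + P.real (A n) * ρ := by
    intro n M
    obtain ⟨k, hk⟩ := exists_nat_gt ((c + M) ^ 2 / v)
    have hv' : (0 : ℝ) < v := by positivity
    have hk0 : (0 : ℝ) < k := lt_of_le_of_lt (by positivity) hk
    have hk1 : 1 ≤ k := by exact_mod_cast hk0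
    have hD : P.real {ω | ∑ i ∈ Finset.Ico n (n + k), Y i ω < c + M} ≤ ρ := by
      have h := map_sum_gaussianReal hY hind hlaw (Finset.Ico n (n + k))
      have hle : (gaussianReal (k * m) (k * v)).real (Iio (c + M)) ≤ ρ := by
        refine gaussianReal_real_Iio_le (by positivity) (mul_ne_zero (by exact_mod_cast hk0.ne') hv)
          (Real.le_sqrt_of_sq_le ?_)
        rw [div_lt_iff₀ hv'] at hk
        push_cast
        exact hk.le
      rw [Nat.card_Ico, Nat.add_sub_cancel_left] at h
      rwa [← h, map_measureReal_apply (by fun_prop) measurableSet_Iio] at hle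
    have hsub : (⋂ n, A n) ⊆ {ω | ∑ i ∈ Finset.range n, Y i ω ≤ -M} ∪
        (A n ∩ {ω | ∑ i ∈ Finset.Ico n (n + k), Y i ω < c + M}) := by
      intro ω hω
      rw [mem_iInter] at hω
      by_cases hn : ∑ i ∈ Finset.range n, Y i ω ≤ -M
      · exact Or.inl hn
      · refine Or.inr ⟨hω n, ?_⟩
        have h1 := hω (n + k) (n + k) (by omega) le_rfl
        rw [← Finset.sum_range_add_sum_Ico _ (Nat.le_add_right n k)] at h1
        simp only [mem_ofPred_eq]
        linarith
    calc q ≤ _ := measureReal_mono hsub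
      _ ≤ _ := measureReal_union_le _ _
      _ ≤ _ := by
        rw [real_inter_partialSums_lt hY hind n k c (c + M)]
        gcongr
  have hstep : ∀ n, q ≤ P.real (A n) * ρ := by
    intro n
    have : IsProbabilityMeasure (P.map fun ω => ∑ i ∈ Finset.range n, Y i ω) :=
      Measure.isProbabilityMeasure_map (by fun_prop)
    have ht := ((tendsto_cdf_atBot (P.map fun ω => ∑ i ∈ Finset.range n, Y i ω)).comp
      tendsto_neg_atTop_atBot).add_const (P.real (A n) * ρ)
    rw [zero_add] at ht
    refine ge_of_tendsto' ht fun M => ?_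
    simp only [Function.comp, cdf_eq_real]
    rw [map_measureReal_apply (by fun_prop) measurableSet_Iic]
    exact hbound n M
  have hlim : Tendsto (fun n => P.real (A n)) atTop (nhds q) :=
    (ENNReal.tendsto_toReal (measure_ne_top _ _)).comp
      (tendsto_measure_iInter_atTop (fun n => (hAmeas n).nullMeasurableSet) hAanti
        ⟨0, measure_ne_top _ _⟩)
  have hq : q ≤ q * ρ := ge_of_tendsto' (hlim.mul_const ρ) hstep
  have hq0 : q = 0 := by
    have : 0 ≤ q := measureReal_nonneg
    nlinarith
  have hcompl : {ω | ∃ t, 1 ≤ t ∧ c ≤ ∑ i ∈ Finset.range t, Y i ω} = (⋂ n, A n)ᶜ := by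
    ext ω
    simp only [hA, mem_ofPred_eq, mem_compl_iff, mem_iInter]
    push Not
    exact ⟨fun ⟨t, h1, h2⟩ => ⟨t, t, h1, le_rfl, h2⟩, fun ⟨_, t, h1, _, h2⟩ => ⟨t, h1, h2⟩⟩
  rw [hcompl, prob_compl_eq_one_iff (MeasurableSet.iInter hAmeas)]
  exact (measureReal_eq_zero_iff).1 hq0

/-- A Gaussian random walk with negative drift stays below a high enough level with positive
probability. -/
lemma exists_gaussian_walk_hits_lt_one [IsProbabilityMeasure P]
    (hY : ∀ i, Measurable (Y i)) (hind : iIndepFun Y P)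
    (hlaw : ∀ i, P.map (Y i) = gaussianReal m v) (hm : m < 0) (hv : v ≠ 0) :
    ∃ c : ℝ, 0 < c ∧ P {ω | ∃ t, 1 ≤ t ∧ c ≤ ∑ i ∈ Finset.range t, Y i ω} < 1 := by
  have hv' : (0 : ℝ) < v := by positivity
  set θ : ℝ := -m / v with hθ
  have hθ0 : 0 < θ := div_pos (by linarith) hv'
  set r : ℝ := Real.exp (m * θ / 2)
  have hr0 : 0 < r := Real.exp_pos _
  have hr1 : r < 1 := Real.exp_lt_one_iff.2 (by nlinarith)
  have hmgf : ∀ t : ℕ, mgf (fun ω => ∑ i ∈ Finset.range t, Y i ω) P θ = r ^ t := by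
    intro t
    have h := map_sum_gaussianReal hY hind hlaw (Finset.range t)
    rw [mgf_gaussianReal h, ← Real.exp_nat_mul]
    congr 1
    simp only [Finset.card_range, hθ]
    push_cast
    field_simp
    ring
  have htail : ∀ (c : ℝ) (t : ℕ), P {ω | c ≤ ∑ i ∈ Finset.range t, Y i ω} ≤
      ENNReal.ofReal (Real.exp (-θ * c) * r ^ t) := by
    intro c t
    have h := measure_ge_le_exp_mul_mgf (μ := P) (X := fun ω => ∑ i ∈ Finset.range t, Y i ω)
      c hθ0.le (by_contra fun hint => (pow_pos hr0 t).ne' ((hmgf t).symm.trans (mgf_undef hint)))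
    rw [hmgf] at h
    exact (ENNReal.le_ofReal_iff_toReal_le (measure_ne_top _ _) (by positivity)).2 h
  have hsum : ∀ c : ℝ, P {ω | ∃ t, 1 ≤ t ∧ c ≤ ∑ i ∈ Finset.range t, Y i ω} ≤
      ENNReal.ofReal (Real.exp (-θ * c) * (1 - r)⁻¹) := by
    intro c
    have hsub : {ω | ∃ t, 1 ≤ t ∧ c ≤ ∑ i ∈ Finset.range t, Y i ω} ⊆
        ⋃ t : ℕ, {ω | c ≤ ∑ i ∈ Finset.range t, Y i ω} := fun ω ⟨t, _, ht⟩ =>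
      mem_iUnion.2 ⟨t, ht⟩
    have hs : HasSum (fun t : ℕ => Real.exp (-θ * c) * r ^ t) (Real.exp (-θ * c) * (1 - r)⁻¹) :=
      (hasSum_geometric_of_lt_one hr0.le hr1).mul_left _
    calc _ ≤ _ := measure_mono hsub
      _ ≤ _ := measure_iUnion_le _
      _ ≤ _ := ENNReal.tsum_le_tsum (htail c)
      _ = _ := by
        rw [← ENNReal.ofReal_tsum_of_nonneg (fun t => by positivity) hs.summable, hs.tsum_eq]
  have hlim : Tendsto (fun c : ℝ => Real.exp (-θ * c) * (1 - r)⁻¹) atTop (nhds 0) := by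
    have := (Real.tendsto_exp_atBot.comp
      (tendsto_id.const_mul_atTop_of_neg (neg_lt_zero.2 hθ0))).mul_const (1 - r)⁻¹
    rwa [zero_mul] at this
  obtain ⟨c, hc1, hc0⟩ := ((hlim.eventually_lt_const one_pos).and (eventually_gt_atTop 0)).exists
  exact ⟨c, hc0, (hsum c).trans_lt (by rwa [ENNReal.ofReal_lt_one])⟩

end IIDGaussian

section IIDProduct

variable {𝒳 : Type*} [MeasurableSpace 𝒳] {π : Measure 𝒳} [IsProbabilityMeasure π]
  {P : Measure (ℕ → 𝒳)}

lemma IsIIDProduct.map_eval (h : IsIIDProduct π P) (i : ℕ) :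
    P.map (fun x => x i) = π := by
  have hm := congrArg (Measure.map (fun y : Fin (i + 1) → 𝒳 => y (Fin.last i))) (h.2 (i + 1))
  rw [Measure.map_map (by fun_prop) (by fun_prop),
    (measurePreserving_eval (fun _ : Fin (i + 1) => π) (Fin.last i)).map_eq] at hm
  exact hm

lemma IsIIDProduct.iIndepFun_eval (h : IsIIDProduct π P) :
    iIndepFun (fun (i : ℕ) (x : ℕ → 𝒳) => x i) P := by
  have := h.1
  have hfin : ∀ n : ℕ, iIndepFun (fun (i : Fin n) (x : ℕ → 𝒳) => x i.val) P := fun n => by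
    rw [iIndepFun_iff_map_fun_eq_pi_map (fun i => (measurable_pi_apply i.val).aemeasurable), h.2 n]
    simp_rw [h.map_eval]
  rw [iIndepFun_iff_finset]
  intro s
  let g : s → Fin (s.sup id + 1) := fun i =>
    ⟨i, Nat.lt_succ_of_le (Finset.le_sup (f := id) i.2)⟩
  exact (hfin (s.sup id + 1)).precomp (g := g) fun i j hij => by
    exact Subtype.ext (congrArg Fin.val hij)

end IIDProduct

/-- One-step log-wealth increment of the Gaussian-shift bet. -/
def gaussLogBet (σ : ℝ≥0) (a x : ℝ) : ℝ :=
  a * x / (σ : ℝ) ^ 2 - a ^ 2 / (2 * (σ : ℝ) ^ 2)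

@[fun_prop]
lemma measurable_gaussLogBet (σ : ℝ≥0) (a : ℝ) : Measurable (gaussLogBet σ a) := by
  unfold gaussLogBet
  fun_prop

lemma gaussWealth_eq_exp_sum (σ : ℝ≥0) (a : ℝ) (t : ℕ) (x : ℕ → ℝ) :
    gaussWealth σ a t x = Real.exp (∑ i ∈ Finset.range t, gaussLogBet σ a (x i)) := by
  induction t with
  | zero => simp [gaussWealth]
  | succ t ih => rw [gaussWealth, ih, Finset.sum_range_succ, Real.exp_add, gaussLogBet]

lemma gaussianReal_map_gaussLogBet {σ : ℝ≥0} (hσ : 0 < σ) (μ a : ℝ) :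
    (gaussianReal μ (σ ^ 2)).map (gaussLogBet σ a) =
      gaussianReal ((a * μ - a ^ 2 / 2) / (σ : ℝ) ^ 2) (‖a‖₊ ^ 2 / σ ^ 2) := by
  have h : gaussLogBet σ a =
      (fun y => y - a ^ 2 / (2 * (σ : ℝ) ^ 2)) ∘ fun x => (a / (σ : ℝ) ^ 2) * x := by
    ext x
    simp only [gaussLogBet, Function.comp]
    ring
  have hσ' : (0 : ℝ) < σ := hσ
  rw [h, ← Measure.map_map (by fun_prop) (by fun_prop), gaussianReal_map_const_mul,
    gaussianReal_map_sub_const]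
  congr 1
  · field_simp
  · ext
    push_cast
    simp only [Real.norm_eq_abs, sq_abs]
    field_simp

lemma le_mul_gaussWealth_iff {b w : ℝ} (hb : 0 < b) (hw : 0 < w) (σ : ℝ≥0) (a : ℝ) (t : ℕ)
    (x : ℕ → ℝ) :
    b ≤ w * gaussWealth σ a t x ↔
      Real.log (b / w) ≤ ∑ i ∈ Finset.range t, gaussLogBet σ a (x i) := by
  rw [gaussWealth_eq_exp_sum, Real.log_le_iff_le_exp (by positivity), div_le_iff₀' hw]

/-- The constant Gaussian-shift bet has power one from every admissible initial wealth iff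
`0 < a ≤ 2μ`. -/
lemma gaussWealth_power_one_iff {σ : ℝ≥0} (hσ : 0 < σ) {μ : ℝ} (hμ : 0 < μ) {b : ℝ} (hb : 0 < b)
    {P : Measure (ℕ → ℝ)} (hP : IsIIDProduct (gaussianReal μ (σ ^ 2)) P) (a : ℝ) :
    (∀ w : ℝ, 0 < w → w < b → P {x | ∃ t : ℕ, 1 ≤ t ∧ b ≤ w * gaussWealth σ a t x} = 1) ↔
      0 < a ∧ a ≤ 2 * μ := by
  have := hP.1
  have hσ' : (0 : ℝ) < σ := hσ
  have hY : ∀ i : ℕ, Measurable fun x : ℕ → ℝ => gaussLogBet σ a (x i) := fun i => by fun_prop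
  have hind : iIndepFun (fun (i : ℕ) (x : ℕ → ℝ) => gaussLogBet σ a (x i)) P :=
    hP.iIndepFun_eval.comp _ fun _ => measurable_gaussLogBet σ a
  have hlaw : ∀ i : ℕ, P.map (fun x : ℕ → ℝ => gaussLogBet σ a (x i)) =
      gaussianReal ((a * μ - a ^ 2 / 2) / (σ : ℝ) ^ 2) (‖a‖₊ ^ 2 / σ ^ 2) := fun i => by
    rw [← gaussianReal_map_gaussLogBet hσ, ← hP.map_eval i,
      Measure.map_map (by fun_prop) (by fun_prop)]
    rfl
  constructor
  · intro h
    by_contra hcon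
    rcases eq_or_ne a 0 with rfl | ha
    · have h1 := h (b / 2) (by positivity) (by linarith)
      have hempty : {x : ℕ → ℝ | ∃ t : ℕ, 1 ≤ t ∧ b ≤ b / 2 * gaussWealth σ 0 t x} = ∅ := by
        ext x
        simp only [gaussWealth_eq_exp_sum, gaussLogBet, mem_ofPred_eq, mem_empty_iff_false,
          iff_false]
        rintro ⟨t, -, ht⟩
        simp at ht
        linarith
      simp [hempty] at h1
    · have hdrift : (a * μ - a ^ 2 / 2) / (σ : ℝ) ^ 2 < 0 := by
        refine div_neg_of_neg_of_pos ?_ (by positivity)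
        rcases lt_or_gt_of_ne ha with ha | ha
        · nlinarith
        · have : 2 * μ < a := not_le.1 fun h' => hcon ⟨ha, h'⟩
          nlinarith
      obtain ⟨c, hc0, hc⟩ := exists_gaussian_walk_hits_lt_one hY hind hlaw hdrift
        (div_ne_zero (pow_ne_zero _ (nnnorm_ne_zero_iff.2 ha)) (pow_ne_zero _ hσ.ne'))
      have hw : 0 < b * Real.exp (-c) := by positivity
      have h1 := h (b * Real.exp (-c)) hw
        (mul_lt_of_lt_one_right hb (Real.exp_lt_one_iff.2 (by linarith)))
      have hlog : Real.log (b / (b * Real.exp (-c))) = c := by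
        rw [div_mul_cancel_left₀ hb.ne', Real.exp_neg, inv_inv, Real.log_exp]
      simp_rw [le_mul_gaussWealth_iff hb hw, hlog] at h1
      exact hc.ne h1
  · rintro ⟨ha, ha'⟩ w hw -
    simp_rw [le_mul_gaussWealth_iff hb hw]
    refine gaussian_walk_hits hY hind hlaw (div_nonneg ?_ (by positivity))
      (div_ne_zero (pow_ne_zero _ (nnnorm_ne_zero_iff.2 ha.ne')) (pow_ne_zero _ hσ.ne')) _
    nlinarith

lemma integral_gaussLogBet {σ : ℝ≥0} (μ a : ℝ) :
    ∫ x, gaussLogBet σ a x ∂(gaussianReal μ (σ ^ 2)) = (a * μ - a ^ 2 / 2) / (σ : ℝ) ^ 2 := by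
  have hint : Integrable (fun x : ℝ => x) (gaussianReal μ (σ ^ 2)) :=
    memLp_one_iff_integrable.1 (memLp_id_gaussianReal 1)
  simp only [gaussLogBet]
  rw [integral_sub ((hint.const_mul a).div_const _) (integrable_const _), integral_div,
    integral_const_mul, integral_id_gaussianReal]
  simp only [integral_const, probReal_univ, one_smul]
  ring

/-- The likelihood ratio of `𝒩(μ,σ²)` against `𝒩(0,σ²)` is the Gaussian-shift bet `φ(μ,·)`. -/
lemma gaussianReal_eq_withDensity_gaussLogBet {σ : ℝ≥0} (hσ : 0 < σ) (μ : ℝ) :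
    gaussianReal μ (σ ^ 2) = (gaussianReal 0 (σ ^ 2)).withDensity
      (fun x => ENNReal.ofReal (Real.exp (gaussLogBet σ μ x))) := by
  have hv : σ ^ 2 ≠ 0 := pow_ne_zero _ hσ.ne'
  have hσ' : (0 : ℝ) < σ := hσ
  rw [gaussianReal_of_var_ne_zero _ hv, gaussianReal_of_var_ne_zero _ hv,
    ← withDensity_mul _ (measurable_gaussianPDF _ _) (by fun_prop)]
  congr 1
  ext x
  rw [Pi.mul_apply, gaussianPDF, gaussianPDF, ← ENNReal.ofReal_mul (gaussianPDFReal_nonneg _ _ _)]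
  congr 1
  rw [gaussianPDFReal, gaussianPDFReal, mul_assoc _ (Real.exp _), ← Real.exp_add]
  congr 2
  simp only [gaussLogBet]
  push_cast
  field_simp
  ring

lemma integral_log_rnDeriv_gaussianReal {σ : ℝ≥0} (hσ : 0 < σ) (μ : ℝ) :
    ∫ x, Real.log (((gaussianReal μ (σ ^ 2)).rnDeriv (gaussianReal 0 (σ ^ 2)) x).toReal)
        ∂(gaussianReal μ (σ ^ 2)) = μ ^ 2 / (2 * (σ : ℝ) ^ 2) := by
  have hv : σ ^ 2 ≠ 0 := pow_ne_zero _ hσ.ne'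
  have hac : gaussianReal μ (σ ^ 2) ≪ gaussianReal 0 (σ ^ 2) :=
    (gaussianReal_absolutelyContinuous μ hv).trans (gaussianReal_absolutelyContinuous' 0 hv)
  have hrn : (gaussianReal μ (σ ^ 2)).rnDeriv (gaussianReal 0 (σ ^ 2))
      =ᵐ[gaussianReal 0 (σ ^ 2)] fun x => ENNReal.ofReal (Real.exp (gaussLogBet σ μ x)) := by
    rw [gaussianReal_eq_withDensity_gaussLogBet hσ μ]
    exact Measure.rnDeriv_withDensity _ (by fun_prop)
  have hlog : (fun x => Real.log
      (((gaussianReal μ (σ ^ 2)).rnDeriv (gaussianReal 0 (σ ^ 2)) x).toReal))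
      =ᵐ[gaussianReal μ (σ ^ 2)] gaussLogBet σ μ := by
    filter_upwards [hac.ae_eq hrn] with x hx
    rw [hx, ENNReal.toReal_ofReal (Real.exp_pos _).le, Real.log_exp]
  rw [integral_congr_ae hlog, integral_gaussLogBet]
  ring

theorem gaussian_power_characterization
    (σ : ℝ≥0) (hσ : 0 < σ) (μ : ℝ) (hμ : 0 < μ)
    (α : ℝ≥0) (hα : 0 < α) (hα1 : α < 1) (T : ℝ) (hT : 0 < T)
    (P₁ : Measure (ℕ → ℝ)) (hP₁ : IsIIDProduct (gaussianReal μ (σ ^ 2)) P₁) :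
    -- the log-growth of the Gaussian-shift bet
    (∀ a : ℝ,
      (∫ x, Real.log (Real.exp (a * x / (σ : ℝ) ^ 2 - a ^ 2 / (2 * (σ : ℝ) ^ 2)))
          ∂(gaussianReal μ (σ ^ 2)))
        = (a * μ - a ^ 2 / 2) / (σ : ℝ) ^ 2) ∧
    -- power one iff `0 < a ≤ 2μ`
    (∀ a : ℝ,
      (∀ w : ℝ, 0 < w → w < ((α : ℝ))⁻¹ →
          P₁ {x | ∃ t : ℕ, 1 ≤ t ∧ ((α : ℝ))⁻¹ ≤ w * gaussWealth σ a t x} = 1)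
        ↔ (0 < a ∧ a ≤ 2 * μ)) ∧
    -- in particular for the EDO action `a⋆ = μ + 2σ²/(μT)`: power one iff `T ≥ 2σ²/μ²`
    ((∀ w : ℝ, 0 < w → w < ((α : ℝ))⁻¹ →
        P₁ {x | ∃ t : ℕ, 1 ≤ t ∧
          ((α : ℝ))⁻¹ ≤ w * gaussWealth σ (μ + 2 * (σ : ℝ) ^ 2 / (μ * T)) t x} = 1)
      ↔ 2 * (σ : ℝ) ^ 2 / μ ^ 2 ≤ T) ∧
    -- and `2σ²/μ² = KL(π₁‖π₀)⁻¹`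
    (∫ x, Real.log (((gaussianReal μ (σ ^ 2)).rnDeriv (gaussianReal 0 (σ ^ 2)) x).toReal)
        ∂(gaussianReal μ (σ ^ 2))) = μ ^ 2 / (2 * (σ : ℝ) ^ 2) ∧
    2 * (σ : ℝ) ^ 2 / μ ^ 2 =
      (∫ x, Real.log (((gaussianReal μ (σ ^ 2)).rnDeriv (gaussianReal 0 (σ ^ 2)) x).toReal)
        ∂(gaussianReal μ (σ ^ 2)))⁻¹ := by
  have hσ' : (0 : ℝ) < σ := hσ
  have hb : (0 : ℝ) < (α : ℝ)⁻¹ := inv_pos.2 hα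
  have hKL := integral_log_rnDeriv_gaussianReal hσ μ
  refine ⟨fun a => ?_, gaussWealth_power_one_iff hσ hμ hb hP₁, ?_, hKL, ?_⟩
  · simp_rw [Real.log_exp]
    exact integral_gaussLogBet μ a
  · rw [gaussWealth_power_one_iff hσ hμ hb hP₁, and_iff_right (by positivity)]
    have hiff : μ + 2 * (σ : ℝ) ^ 2 / (μ * T) ≤ 2 * μ ↔ 2 * (σ : ℝ) ^ 2 / (μ * T) ≤ μ := by
      constructor <;> intro h <;> linarith
    rw [hiff, div_le_iff₀ (by positivity), div_le_iff₀ (by positivity)]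
    constructor <;> intro h <;> linarith
  · rw [hKL, inv_div]

end
end
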